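/- Let 1 ≤ m < k and let V_m(ℝᵏ) be the Stiefel manifold of orthonormal m-frames, i.e., the set of m-tuples (v₁, …, v_m) of vectors of the Euclidean space ℝᵏ that form an orthonormal family, with the subspace topology from (ℝᵏ)ᵐ. Then V_m(ℝᵏ) is nonempty and path-connected, and for every natural number n with 1 ≤ n ≤ k − m − 1, every continuous map from the n-sphere Sⁿ to V_m(ℝᵏ) is null-homotopic (equivalently, the homotopy group π_n(V_m(ℝᵏ)) is trivial for n ≤ k − m − 1). -/

import Mathlib

/-- The Stiefel manifold `V_m(ℝᵏ)` of orthonormal `m`-frames in Euclidean `k`-space,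
topologized as a subspace of `(ℝᵏ)ᵐ`. -/
def StiefelFrames (k m : ℕ) : Type :=
  {v : Fin m → EuclideanSpace ℝ (Fin k) // Orthonormal ℝ v}

noncomputable instance (k m : ℕ) : TopologicalSpace (StiefelFrames k m) :=
  instTopologicalSpaceSubtype

open InnerProductSpace Module Set
open scoped Manifold ContDiff Topology

theorem smooth_approx {E F : Type*} [NormedAddCommGroup E] [NormedSpace ℝ E]
    [FiniteDimensional ℝ E] [NormedAddCommGroup F] [NormedSpace ℝ F]
    (f : E → F) (hf : Continuous f) (ε : ℝ) (hε : 0 < ε) :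
    ∃ g : E → F, ContDiff ℝ 1 g ∧ ∀ x, ‖g x - f x‖ < ε := by
  obtain ⟨g, hg⟩ := exists_contMDiffMap_forall_mem_convex_of_local_const (n := 1) 𝓘(ℝ, E)
    (t := fun x => Metric.ball (f x) ε) (fun x => convex_ball _ _) (fun x => by
      refine ⟨f x, ?_⟩
      have := hf.continuousAt.eventually (Metric.ball_mem_nhds (f x) hε)
      filter_upwards [this] with y hy
      rw [Metric.mem_ball'] 
      exact hy)
  refine ⟨g, by exact_mod_cast g.contMDiff.contDiff, fun x => ?_⟩
  simpa [dist_eq_norm] using hg x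

theorem li_of_close {k m : ℕ} (v w : Fin m → EuclideanSpace ℝ (Fin k)) (hv : Orthonormal ℝ v)
    (h : ‖w - v‖ * m < 1) : LinearIndependent ℝ w := by
  rw [Fintype.linearIndependent_iff]
  intro c hc
  have key : ∀ i, |c i| ≤ (∑ j, |c j|) * ‖w - v‖ := by
    intro i
    have h1 : inner ℝ (v i) (∑ j, c j • v j) = c i := by
      rw [hv.inner_right_fintype]
    have h2 : ∑ j, c j • v j = - ∑ j, c j • (w - v) j := by
      simp only [Pi.sub_apply, smul_sub, Finset.sum_sub_distrib, hc]; simp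
    calc |c i| ≤ ‖v i‖ * ‖∑ j, c j • v j‖ := by
          conv_lhs => rw [← h1]
          exact abs_real_inner_le_norm _ _
      _ = ‖∑ j, c j • (w - v) j‖ := by rw [hv.1, h2, norm_neg, one_mul]
      _ ≤ ∑ j, ‖c j • (w - v) j‖ := norm_sum_le _ _
      _ ≤ ∑ j, |c j| * ‖w - v‖ := by
          refine Finset.sum_le_sum fun j _ => ?_
          rw [norm_smul, Real.norm_eq_abs]
          gcongr
          exact norm_le_pi_norm _ j
      _ = _ := by rw [Finset.sum_mul]
  have hs : ∑ j, |c j| ≤ (∑ j, |c j|) * (‖w - v‖ * m) := by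
    calc ∑ j, |c j| ≤ ∑ j : Fin m, (∑ j, |c j|) * ‖w - v‖ := Finset.sum_le_sum fun i _ => key i
      _ = _ := by simp; ring
  have h0 : 0 ≤ ∑ j, |c j| := Finset.sum_nonneg fun _ _ => abs_nonneg _
  have hz : ∑ j, |c j| = 0 := by nlinarith
  intro i
  rw [Finset.sum_eq_zero_iff_of_nonneg (fun _ _ => abs_nonneg _)] at hz
  simpa using hz i (Finset.mem_univ i)

noncomputable def badMap {E : Type*} {k m : ℕ} (g : E → Fin m → EuclideanSpace ℝ (Fin k))
    (j : Fin m) (p : E × (({i // i ≠ j}) → ℝ) × ({i // i ≠ j} → EuclideanSpace ℝ (Fin k))) :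
    Fin m → EuclideanSpace ℝ (Fin k) := fun i =>
  if h : i = j then g p.1 j + ∑ l, p.2.1 l • (g p.1 l.1 - p.2.2 l) else p.2.2 ⟨i, h⟩

theorem badMap_contDiff {E : Type*} [NormedAddCommGroup E] [NormedSpace ℝ E]
    {k m : ℕ} (g : E → Fin m → EuclideanSpace ℝ (Fin k)) (hg : ContDiff ℝ 1 g) (j : Fin m) :
    ContDiff ℝ 1 (badMap g j) := by
  rw [contDiff_pi]
  intro i
  have hg' : ∀ i, ContDiff ℝ 1 (fun x => g x i) := fun i => contDiff_pi.1 hg i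
  unfold badMap
  by_cases h : i = j
  · simp only [h, dite_true]
    have := fun i => (hg' i).comp (contDiff_fst (𝕜 := ℝ) (E := E) (F := (({i // i ≠ j}) → ℝ) × ({i // i ≠ j} → EuclideanSpace ℝ (Fin k))))
    refine (this j).add (ContDiff.sum fun l _ => ?_)
    have hl := this l
    simp only [Function.comp_def] at hl
    fun_prop
  · simp only [h, dite_false]
    fun_prop

theorem generic_shift {E : Type*} [NormedAddCommGroup E] [NormedSpace ℝ E] [FiniteDimensional ℝ E]
    {k m : ℕ} (hd : finrank ℝ E + m ≤ k)
    (g : E → Fin m → EuclideanSpace ℝ (Fin k)) (hg : ContDiff ℝ 1 g) (ε : ℝ) (hε : 0 < ε) :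
    ∃ A : Fin m → EuclideanSpace ℝ (Fin k), ‖A‖ < ε ∧ ∀ x, LinearIndependent ℝ (g x - A) := by
  rcases Nat.eq_zero_or_pos m with rfl | hm
  · exact ⟨0, by rw [norm_zero]; exact hε, fun x => linearIndependent_empty_type⟩
  have hdim : dimH (⋃ j, range (badMap g j)) <
      finrank ℝ (Fin m → EuclideanSpace ℝ (Fin k)) := by
    rw [dimH_iUnion]
    have hle : ∀ j, dimH (range (badMap g j)) ≤ ((finrank ℝ E + ((m - 1) + (m - 1) * k) : ℕ) : ENNReal) := by
      intro j
      refine (badMap_contDiff g hg j).dimH_range_le.trans ?_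
      apply le_of_eq
      congr 1
      rw [finrank_prod, finrank_prod, finrank_fintype_fun_eq_card, finrank_pi_fintype]
      simp
    refine lt_of_le_of_lt (iSup_le hle) ?_
    rw [finrank_pi_fintype]
    simp only [finrank_euclideanSpace, Fintype.card_fin, Finset.sum_const, Finset.card_univ, smul_eq_mul]
    norm_cast
    obtain ⟨m, rfl⟩ : ∃ n, m = n + 1 := ⟨m - 1, by omega⟩
    simp only [Nat.add_sub_cancel, add_mul, one_mul]
    omega
  have hdense := dense_compl_of_dimH_lt_finrank hdim
  obtain ⟨A, hA, hAm⟩ := hdense.exists_mem_open (Metric.isOpen_ball (x := 0) (ε := ε)) ⟨0, by simpa using hε⟩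
  refine ⟨A, by simpa using hAm, fun x => ?_⟩
  rw [Fintype.linearIndependent_iff]
  intro c hc j
  by_contra hj
  apply hA
  rw [mem_iUnion]
  refine ⟨j, ⟨x, fun l => c l / c j, fun l => A l⟩, ?_⟩
  funext i
  unfold badMap
  split_ifs with h
  · subst h
    dsimp only
    have h1 : ∑ l : {l // l ≠ i}, (c l / c i) • (g x l - A l) = - (g x i - A i) := by
      have h2 := Fintype.sum_eq_add_sum_subtype_ne (fun l => (c l / c i) • (g x l - A l)) i
      have h3 : ∑ l, (c l / c i) • (g x l - A l) = 0 := by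
        have : ∀ l, (c l / c i) • (g x l - A l) = (c i)⁻¹ • (c l • (g x - A) l) := by
          intro l; rw [smul_smul, div_eq_inv_mul]; rfl
        simp only [this, ← Finset.smul_sum, hc, smul_zero]
      rw [h3, div_self hj, one_smul] at h2
      exact (neg_eq_of_add_eq_zero_right h2.symm).symm
    rw [h1]; abel
  · rfl

theorem gs_continuousOn (k m : ℕ) :
    ContinuousOn (fun f : Fin m → EuclideanSpace ℝ (Fin k) => gramSchmidtNormed ℝ f)
      {f | LinearIndependent ℝ f} := by
  have h : ∀ n : Fin m, ContinuousOn (fun f : Fin m → EuclideanSpace ℝ (Fin k) =>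
      gramSchmidt ℝ f n) {f | LinearIndependent ℝ f} := by
    intro n
    induction n using WellFoundedLT.induction with
    | _ n ih =>
      simp only [gramSchmidt_def ℝ _ n, Submodule.starProjection_singleton]
      refine ((continuous_apply n).continuousOn).sub (continuousOn_finsetSum _ fun i hi => ?_)
      have hc := ih i (Finset.mem_Iio.1 hi)
      refine ContinuousOn.smul (ContinuousOn.div (hc.inner (𝕜 := ℝ) (continuous_apply n).continuousOn) ?_ ?_) hc
      · exact (hc.norm.pow 2)
      · intro f hf
        have := gramSchmidt_ne_zero i hf
        simpa using this
  refine continuousOn_pi.2 fun n => ?_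
  unfold gramSchmidtNormed
  have hn : ContinuousOn (fun f : Fin m → EuclideanSpace ℝ (Fin k) => ‖gramSchmidt ℝ f n‖)
      {f | LinearIndependent ℝ f} := (h n).norm
  refine ContinuousOn.smul (hn.inv₀ ?_) (h n)
  · intro f hf
    have := gramSchmidt_ne_zero n hf
    simpa using this

theorem gs_of_orthonormal {k m : ℕ} {f : Fin m → EuclideanSpace ℝ (Fin k)} (hf : Orthonormal ℝ f) :
    gramSchmidtNormed ℝ f = f := by
  funext n
  unfold gramSchmidtNormed
  rw [gramSchmidt_of_orthogonal ℝ (fun i j hij => hf.2 hij), hf.1]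
  simp

theorem main_lemma {E : Type*} [NormedAddCommGroup E] [NormedSpace ℝ E] [FiniteDimensional ℝ E]
    {k m : ℕ} (hd : finrank ℝ E + m ≤ k)
    (f : E → Fin m → EuclideanSpace ℝ (Fin k)) (hf : Continuous f) :
    ∃ g : E → Fin m → EuclideanSpace ℝ (Fin k), Continuous g ∧ (∀ x, LinearIndependent ℝ (g x)) ∧
      ∀ x, Orthonormal ℝ (f x) → ∀ t ∈ Icc (0:ℝ) 1,
        LinearIndependent ℝ (f x + t • (g x - f x)) := by
  have hε : (0:ℝ) < 1 / (2 * (m + 1)) := by positivity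
  obtain ⟨g, hg, hgf⟩ := smooth_approx f hf _ hε
  obtain ⟨A, hA, hli⟩ := generic_shift hd g hg _ hε
  refine ⟨fun x => g x - A, hg.continuous.sub continuous_const, hli, fun x hx t ht => ?_⟩
  apply li_of_close (f x) _ hx
  rw [add_sub_cancel_left, norm_smul, Real.norm_of_nonneg ht.1]
  have h1 : ‖g x - A - f x‖ ≤ 1 / (m + 1) := by
    have : g x - A - f x = (g x - f x) - A := by abel
    rw [this]
    refine (norm_sub_le _ _).trans ?_
    have h2 := hgf x
    have : (1:ℝ) / (m+1) = 1 / (2 * (m + 1)) + 1 / (2 * (m + 1)) := by field_simp; ring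
    linarith
  calc t * ‖g x - A - f x‖ * m ≤ 1 * (1 / (m + 1)) * m := by
        gcongr; exact ht.2
    _ < 1 := by
        rw [one_mul, one_div, inv_mul_lt_iff₀ (by positivity)]; linarith

noncomputable def retr (k m : ℕ) (f : {f : Fin m → EuclideanSpace ℝ (Fin k) // LinearIndependent ℝ f}) :
    StiefelFrames k m := ⟨gramSchmidtNormed ℝ f.1, gramSchmidtNormed_orthonormal f.2⟩

theorem retr_continuous (k m : ℕ) : Continuous (retr k m) :=
  Continuous.subtype_mk (continuousOn_iff_continuous_domRestrict.1 (gs_continuousOn k m)) _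

theorem retr_eq {k m : ℕ} (v : StiefelFrames k m) (h) : retr k m ⟨v.1, h⟩ = v :=
  Subtype.ext (gs_of_orthonormal v.2)

theorem sphere_null {k m n : ℕ} (hd : n + 1 + m ≤ k)
    (φ : C(Metric.sphere (0 : EuclideanSpace ℝ (Fin (n + 1))) 1, StiefelFrames k m)) :
    ∃ y : StiefelFrames k m, φ.Homotopic (ContinuousMap.const _ y) := by
  have hφ : Continuous fun x => (φ x).1 := continuous_subtype_val.comp φ.continuous
  obtain ⟨Φ, hΦ⟩ := ContinuousMap.exists_restrict_eq (Y := Fin m → EuclideanSpace ℝ (Fin k))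
    (Metric.isClosed_sphere (x := (0 : EuclideanSpace ℝ (Fin (n + 1)))) (ε := 1)) ⟨_, hφ⟩
  have hΦ' : ∀ x : Metric.sphere (0 : EuclideanSpace ℝ (Fin (n + 1))) 1, Φ x = (φ x).1 :=
    fun x => DFunLike.congr_fun hΦ x
  obtain ⟨g, hg, hli, hline⟩ := main_lemma (by simpa using hd) Φ Φ.continuous
  have hR : Continuous fun x => retr k m ⟨g x, hli x⟩ :=
    (retr_continuous k m).comp (hg.subtype_mk _)
  refine ⟨retr k m ⟨g 0, hli 0⟩, ?_⟩
  have H1 : φ.Homotopic ⟨fun x => retr k m ⟨g x.1, hli x.1⟩, hR.comp continuous_subtype_val⟩ := by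
    have hl : ∀ p : unitInterval × Metric.sphere (0 : EuclideanSpace ℝ (Fin (n + 1))) 1,
        LinearIndependent ℝ (Φ p.2 + (p.1 : ℝ) • (g p.2 - Φ p.2)) := fun p =>
      hline _ (by rw [hΦ']; exact (φ p.2).2) _ p.1.2
    refine ⟨⟨⟨fun p => retr k m ⟨_, hl p⟩, ?_⟩, ?_, ?_⟩⟩
    · refine (retr_continuous k m).comp (Continuous.subtype_mk ?_ _)
      fun_prop
    · intro x
      refine Eq.trans ?_ (retr_eq (φ x) (φ x).2.linearIndependent)
      simp [hΦ']
    · intro x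
      simp
  refine H1.trans ⟨⟨⟨fun p => retr k m ⟨g ((1 - (p.1 : ℝ)) • p.2.1), hli _⟩, ?_⟩, ?_, ?_⟩⟩
  · exact hR.comp (by fun_prop)
  · intro x; simp
  · intro x; simp

theorem stiefel_joined {k m : ℕ} (hd : m < k) (u v : StiefelFrames k m) : Joined u v := by
  let f : ℝ → Fin m → EuclideanSpace ℝ (Fin k) := fun t => u.1 + t • (v.1 - u.1)
  obtain ⟨g, hg, hli, hline⟩ := main_lemma (E := ℝ) (by simpa [add_comm] using hd) f (by fun_prop)
  have hR : Continuous fun x => retr k m ⟨g x, hli x⟩ :=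
    (retr_continuous k m).comp (hg.subtype_mk _)
  have hend : ∀ (w : StiefelFrames k m) (s : ℝ), f s = w.1 → Joined w (retr k m ⟨g s, hli s⟩) := by
    intro w s hs
    have hl : ∀ t : unitInterval, LinearIndependent ℝ (w.1 + (t : ℝ) • (g s - w.1)) := fun t => by
      rw [← hs]
      exact hline s (by rw [hs]; exact w.2) _ t.2
    refine ⟨⟨⟨fun t => retr k m ⟨_, hl t⟩, ?_⟩, ?_, ?_⟩⟩
    · refine (retr_continuous k m).comp (Continuous.subtype_mk ?_ _)
      fun_prop
    · refine Eq.trans ?_ (retr_eq w w.2.linearIndependent)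
      simp
    · simp
  have h1 := hend u 0 (by simp [f])
  have h2 := hend v 1 (by simp [f])
  refine h1.trans (Joined.trans ?_ h2.symm)
  refine ⟨⟨⟨fun t => retr k m ⟨g t, hli t⟩, hR.comp continuous_subtype_val⟩, ?_, ?_⟩⟩ <;> simp

/-- For `1 ≤ m < k`, the Stiefel manifold `V_m(ℝᵏ)` is nonempty and path-connected, and
every continuous map from the sphere `Sⁿ` into it is null-homotopic whenever
`1 ≤ n ≤ k - m - 1`; i.e. `π_n(V_m(ℝᵏ)) = 0` in that range. -/
theorem stiefel_connectivity (k m : ℕ) (hm : 1 ≤ m) (hmk : m < k) :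
    Nonempty (StiefelFrames k m) ∧ PathConnectedSpace (StiefelFrames k m) ∧
    ∀ n : ℕ, 1 ≤ n → n ≤ k - m - 1 →
      ∀ φ : C(Metric.sphere (0 : EuclideanSpace ℝ (Fin (n + 1))) 1, StiefelFrames k m),
        ∃ y : StiefelFrames k m, φ.Homotopic (ContinuousMap.const _ y) := by
  have hne : Nonempty (StiefelFrames k m) :=
    ⟨⟨fun i => EuclideanSpace.basisFun (Fin k) ℝ (Fin.castLE hmk.le i),
      (EuclideanSpace.basisFun (Fin k) ℝ).orthonormal.comp _ (Fin.castLE_injective hmk.le)⟩⟩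
  refine ⟨hne, ⟨hne, stiefel_joined hmk⟩, fun n hn hnk φ => sphere_null (by omega) φ⟩
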